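/- arXiv:1905.02309 — 5 statements merged into one kernel-verified Lean document; each statement's English description precedes it below -/
import Mathlib

section
/- For s ≥ 1, the map η defined by η(w) = { i ∈ {1,3,5,…,2s−3} : i+3 appears before i in w } is a bijection from N_{s,2}(2143) onto the collection of all subsets of {1,3,5,…,2s−3}; moreover, for every w ∈ N_{s,2}(2143) one has inv(w) = (2s−1)(s−1) + |η(w)|. -/
open Polynomial

/-- `σ ∈ S_n` contains the pattern `τ ∈ S_m`. -/
def PermContains {n m : ℕ} (σ : Equiv.Perm (Fin n)) (τ : Equiv.Perm (Fin m)) : Prop :=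
  ∃ f : Fin m → Fin n, StrictMono f ∧ ∀ j k : Fin m, σ (f j) < σ (f k) ↔ τ j < τ k

/-- The pattern `1243` (0-indexed). -/
def pat1243 : Equiv.Perm (Fin 4) := ⟨![0, 1, 3, 2], ![0, 1, 3, 2], by decide, by decide⟩

/-- The pattern `2143` (0-indexed). -/
def pat2143 : Equiv.Perm (Fin 4) := ⟨![1, 0, 3, 2], ![1, 0, 3, 2], by decide, by decide⟩

/-- `w ∈ S_{st}` (a word recorded as a permutation of `Fin (s*t)`, positions and labels both
0-indexed, 0-indexed label `a` standing for the poset label `a+1`) encodes a linear extension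
of the rectangular poset `N_{s,t}`: for every label `a ∈ [st]`, if `t ∤ a` then `a` appears
before `a+1`, and if `a > t` then `a` appears before `a−t`.  ("`a` appears before `b`" means
`w.symm a < w.symm b`.) -/
def IsLinExtN (s t : ℕ) (w : Equiv.Perm (Fin (s * t))) : Prop :=
  (∀ a b : Fin (s * t), (b : ℕ) = (a : ℕ) + 1 → ¬ (t ∣ ((a : ℕ) + 1)) →
      w.symm a < w.symm b) ∧
  (∀ a b : Fin (s * t), (b : ℕ) + t = (a : ℕ) → w.symm a < w.symm b)

/-- The number of inversions of `w`. -/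
def invCount {n : ℕ} (w : Equiv.Perm (Fin n)) : ℕ :=
  (Finset.univ.filter fun p : Fin n × Fin n => p.1 < p.2 ∧ w p.2 < w p.1).card

open Classical in
/-- The polynomial `N_{s,t}(τ)(q) = Σ_{w ∈ N_{s,t}(τ)} q^{inv(w)}`. -/
noncomputable def NPoly (s t : ℕ) {m : ℕ} (τ : Equiv.Perm (Fin m)) : Polynomial ℤ :=
  ∑ w ∈ Finset.univ.filter
      (fun w : Equiv.Perm (Fin (s * t)) => IsLinExtN s t w ∧ ¬ PermContains w τ),
    (X : Polynomial ℤ) ^ invCount w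

open Classical in
/-- `η(w) = { i ∈ {1,3,5,…,2s−3} : i+3 appears before i in w }` (labels are 1-indexed, so the
1-indexed label `i+3` is the 0-indexed label `i+2`, and `i` is the 0-indexed label `i−1`). -/
noncomputable def eta (s : ℕ) (w : Equiv.Perm (Fin (s * 2))) : Finset ℕ :=
  ((Finset.Icc 1 (2 * s - 3)).filter fun i => Odd i).filter fun i =>
    ∃ p q : Fin (s * 2), (p : ℕ) = i + 2 ∧ (q : ℕ) + 1 = i ∧ w.symm p < w.symm q

/-- The noninversions of `w`, as pairs of labels `a < b` with `a` appearing before `b`, are the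
pairs `(a, a + 1)` and `(a, a + 3)` with `a` even and, in the second case, `a + 1 ∉ A`. -/
def NoninversionsGivenBy (A : Finset ℕ) {n : ℕ} (w : Equiv.Perm (Fin n)) : Prop :=
  ∀ a b : Fin n, a < b → (w.symm a < w.symm b ↔
    (a : ℕ) % 2 = 0 ∧ ((b : ℕ) = a + 1 ∨ (b : ℕ) = a + 3 ∧ (a : ℕ) + 1 ∉ A))

theorem IsLinExtN.symm_lt_of_add_mul {s t : ℕ} {w : Equiv.Perm (Fin (s * t))}
    (h : IsLinExtN s t w) (k : ℕ) :
    ∀ a b : Fin (s * t), (b : ℕ) + t * (k + 1) = a → w.symm a < w.symm b := by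
  induction k with
  | zero => intro a b hab; exact h.2 a b (by simpa using hab)
  | succ k ih =>
    intro a b hab
    have hlt : (b : ℕ) + t < s * t := by
      have := a.isLt
      have : t * (k + 1 + 1) = t * (k + 1) + t := by ring
      omega
    refine (ih a ⟨b + t, hlt⟩ ?_).trans (h.2 ⟨b + t, hlt⟩ b rfl)
    rw [← hab]
    ring

theorem IsLinExtN.symm_lt_of_mod_two_eq {s : ℕ} {w : Equiv.Perm (Fin (s * 2))}
    (h : IsLinExtN s 2 w) {a b : Fin (s * 2)} (hab : b < a) (hmod : (a : ℕ) % 2 = (b : ℕ) % 2) :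
    w.symm a < w.symm b := by
  have hab' : (b : ℕ) < a := hab
  exact h.symm_lt_of_add_mul (((a : ℕ) - b) / 2 - 1) a b (by omega)

theorem permContains_pat2143 {n : ℕ} {w : Equiv.Perm (Fin n)} {a b c d : Fin n}
    (hab : a < b) (hbc : b < c) (hcd : c < d) (h₁ : w.symm b < w.symm a)
    (h₂ : w.symm a < w.symm d) (h₃ : w.symm d < w.symm c) : PermContains w pat2143 := by
  refine ⟨![w.symm b, w.symm a, w.symm d, w.symm c], ?_, ?_⟩
  · refine Fin.strictMono_iff_lt_succ.2 fun i => ?_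
    fin_cases i
    · exact h₁
    · exact h₂
    · exact h₃
  · have hp : ∀ i, pat2143 i = ![1, 0, 3, 2] i := fun _ => rfl
    intro j k
    rw [hp, hp]
    fin_cases j <;> fin_cases k <;> simp <;> order

theorem mem_eta_iff {s : ℕ} (w : Equiv.Perm (Fin (s * 2))) {a b : Fin (s * 2)}
    (ha : (a : ℕ) % 2 = 0) (hb : (b : ℕ) = a + 3) :
    (a : ℕ) + 1 ∈ eta s w ↔ w.symm b < w.symm a := by
  have := b.isLt
  unfold _root_.eta
  simp only [Finset.mem_filter, Finset.mem_Icc, Nat.odd_iff]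
  constructor
  · rintro ⟨-, p, q, hp, hq, hpq⟩
    obtain rfl : p = b := Fin.ext (by omega)
    obtain rfl : q = a := Fin.ext (by omega)
    exact hpq
  · exact fun h => ⟨by omega, b, a, by omega, rfl, h⟩

theorem IsLinExtN.noninversionsGivenBy_eta {s : ℕ} {w : Equiv.Perm (Fin (s * 2))}
    (h : IsLinExtN s 2 w) (hw : ¬ PermContains w pat2143) :
    NoninversionsGivenBy (eta s w) w := by
  intro a b hab
  have hab' : (a : ℕ) < b := hab
  have hbn := b.isLt
  by_cases hmod : (b : ℕ) % 2 = (a : ℕ) % 2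
  · exact iff_of_false (h.symm_lt_of_mod_two_eq hab hmod).not_gt (by omega)
  by_cases ha : (a : ℕ) % 2 = 0
  · by_cases h₁ : (b : ℕ) = a + 1
    · exact iff_of_true (h.1 a b h₁ (by omega)) ⟨ha, Or.inl h₁⟩
    by_cases h₃ : (b : ℕ) = a + 3
    · rw [mem_eta_iff w ha h₃, not_lt]
      have hne : w.symm a ≠ w.symm b := w.symm.injective.ne hab.ne
      exact ⟨fun hlt => ⟨ha, Or.inr ⟨h₃, hlt.le⟩⟩,
        fun hle => (hle.2.resolve_left h₁).2.lt_of_ne hne⟩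
    · refine iff_of_false (fun hlt => hw ?_) (by omega)
      let a₂ : Fin (s * 2) := ⟨a + 2, by omega⟩
      let b₂ : Fin (s * 2) := ⟨b - 2, by omega⟩
      have hb₂ : (b₂ : ℕ) + 2 = b := by change (b : ℕ) - 2 + 2 = b; omega
      refine permContains_pat2143 (a := a) (b := a₂) (c := b₂) (d := b) ?_ ?_ ?_
        (h.2 a₂ a rfl) hlt (h.2 b b₂ hb₂)
      · change (a : ℕ) < a + 2; omega
      · change (a : ℕ) + 2 < b - 2; omega
      · change (b : ℕ) - 2 < b; omega
  · refine iff_of_false ?_ (by omega)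
    let a' : Fin (s * 2) := ⟨a - 1, by omega⟩
    have ha' : (a' : ℕ) + 1 = a := by change (a : ℕ) - 1 + 1 = a; omega
    have h₁ : w.symm b < w.symm a' :=
      h.symm_lt_of_mod_two_eq (by change (a' : ℕ) < b; omega) (by omega)
    have h₂ : w.symm a' < w.symm a := h.1 a' a ha'.symm (by omega)
    exact (h₁.trans h₂).not_gt

theorem Equiv.Perm.eq_of_symm_lt_iff {n : ℕ} {v w : Equiv.Perm (Fin n)}
    (h : ∀ a b, v.symm a < v.symm b ↔ w.symm a < w.symm b) : v = w := by
  have hmono : StrictMono (v.trans w.symm) := fun i j hij => by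
    simpa [hij] using h (v i) (v j)
  have hid : ⇑(v.trans w.symm) = id :=
    hmono.range_inj strictMono_id |>.1 (by simp)
  ext i : 1
  exact (Equiv.symm_apply_eq w).1 (congrFun hid i)

namespace NoninversionsGivenBy

variable {A : Finset ℕ} {n s : ℕ}

theorem eq {v w : Equiv.Perm (Fin n)} (hv : NoninversionsGivenBy A v)
    (hw : NoninversionsGivenBy A w) : v = w := by
  have key : ∀ a b, a < b → (v.symm a < v.symm b ↔ w.symm a < w.symm b) :=
    fun a b hab => (hv a b hab).trans (hw a b hab).symm
  refine Equiv.Perm.eq_of_symm_lt_iff fun a b => ?_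
  rcases lt_trichotomy a b with hab | rfl | hab
  · exact key a b hab
  · simp
  · have h₁ := v.symm.injective.ne hab.ne
    have h₂ := w.symm.injective.ne hab.ne
    have := key b a hab
    rw [← not_iff_not, not_lt, not_lt, h₁.le_iff_lt, h₂.le_iff_lt, this]

theorem isLinExtN {w : Equiv.Perm (Fin (s * 2))} (h : NoninversionsGivenBy A w) :
    IsLinExtN s 2 w := by
  refine ⟨fun a b hab ha => (h a b ?_).2 ⟨by omega, Or.inl hab⟩, fun a b hab => ?_⟩
  · change (a : ℕ) < b; omega
  · have hlt : b < a := by change (b : ℕ) < a; omega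
    exact (w.symm.injective.ne hlt.ne').lt_of_le (not_lt.1 fun hba => by
      have := (h b a hlt).1 hba
      omega)

theorem not_permContains {w : Equiv.Perm (Fin n)} (h : NoninversionsGivenBy A w) :
    ¬ PermContains w pat2143 := by
  rintro ⟨f, hf, hp⟩
  have h₁₀ : w (f 1) < w (f 0) := (hp 1 0).2 (by decide)
  have h₀₃ : w (f 0) < w (f 3) := (hp 0 3).2 (by decide)
  have h₃₂ : w (f 3) < w (f 2) := (hp 3 2).2 (by decide)
  have key : ∀ i j, i < j → w (f i) < w (f j) → _ := fun i j hij hlt =>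
    (h _ _ hlt).1 (by simpa using hf hij)
  have k₁ := key 0 3 (by decide) h₀₃
  have k₂ := key 0 2 (by decide) (h₀₃.trans h₃₂)
  have k₃ := key 1 2 (by decide) (h₁₀.trans (h₀₃.trans h₃₂))
  rw [Fin.lt_def] at h₁₀ h₃₂
  omega

theorem eta_eq {w : Equiv.Perm (Fin (s * 2))} (h : NoninversionsGivenBy A w)
    (hA : A ⊆ (Finset.Icc 1 (2 * s - 3)).filter fun i => Odd i) : eta s w = A := by
  ext i
  by_cases hi : i ∈ (Finset.Icc 1 (2 * s - 3)).filter fun i => Odd i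
  · have hi' := hi
    simp only [Finset.mem_filter, Finset.mem_Icc, Nat.odd_iff] at hi'
    let a : Fin (s * 2) := ⟨i - 1, by omega⟩
    let b : Fin (s * 2) := ⟨i + 2, by omega⟩
    have ha : (a : ℕ) + 1 = i := by change i - 1 + 1 = i; omega
    have hb : (b : ℕ) = a + 3 := by change i + 2 = i - 1 + 3; omega
    have hab : a < b := by change (a : ℕ) < b; omega
    have hne := w.symm.injective.ne hab.ne'
    have hm := mem_eta_iff w (a := a) (b := b) (by omega) hb
    rw [ha] at hm
    rw [hm, ← hne.le_iff_lt, ← not_lt, h a b hab, ha]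
    constructor
    · intro hn
      by_contra hiA
      exact hn ⟨by omega, Or.inr ⟨hb, hiA⟩⟩
    · rintro hiA ⟨-, h₁ | h₃⟩
      · omega
      · exact h₃.2 hiA
  · exact iff_of_false (fun h' => hi (Finset.filter_subset _ _ h')) fun h' => hi (hA h')

end NoninversionsGivenBy

/-- Sorting the labels by this key yields the word with noninversions given by `A`. -/
def labelKey (s : ℕ) (A : Finset ℕ) (a : Fin (s * 2)) : ℕ :=
  if (a : ℕ) % 2 = 0 then 4 * s - 2 * a
  else if (a : ℕ) - 2 ∈ A then 4 * s - 2 * a + 4 else 4 * s - 2 * a + 7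

theorem labelKey_injective (s : ℕ) (A : Finset ℕ) : Function.Injective (labelKey s A) := by
  intro a b hab
  have := a.isLt
  have := b.isLt
  refine Fin.ext ?_
  unfold labelKey at hab
  split_ifs at hab <;> omega

theorem labelKey_lt_iff (s : ℕ) (A : Finset ℕ) {a b : Fin (s * 2)} (hab : a < b) :
    labelKey s A a < labelKey s A b ↔
      (a : ℕ) % 2 = 0 ∧ ((b : ℕ) = a + 1 ∨ (b : ℕ) = a + 3 ∧ (a : ℕ) + 1 ∉ A) := by
  have := b.isLt
  rw [Fin.lt_def] at hab
  unfold labelKey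
  by_cases h₃ : (b : ℕ) = a + 3
  · rw [show (b : ℕ) - 2 = a + 1 by omega]
    split_ifs <;> simp_all <;> omega
  · split_ifs <;> omega

theorem exists_noninversionsGivenBy (s : ℕ) (A : Finset ℕ) :
    ∃ w : Equiv.Perm (Fin (s * 2)), NoninversionsGivenBy A w := by
  refine ⟨Tuple.sort (labelKey s A), fun a b hab => ?_⟩
  have hmono : StrictMono (labelKey s A ∘ Tuple.sort (labelKey s A)) :=
    (Tuple.monotone_sort _).strictMono_of_injective
      ((labelKey_injective s A).comp (Equiv.injective _))
  rw [← hmono.lt_iff_lt]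
  simpa using labelKey_lt_iff s A hab

theorem card_filter_fst_lt_snd (n : ℕ) :
    2 * (Finset.univ.filter fun p : Fin n × Fin n => p.1 < p.2).card = n * (n - 1) := by
  have hswap : (Finset.univ.filter fun p : Fin n × Fin n => p.2 < p.1).card =
      (Finset.univ.filter fun p : Fin n × Fin n => p.1 < p.2).card :=
    Finset.card_bij' (fun p _ => p.swap) (fun p _ => p.swap) (by simp) (by simp) (by simp)
      (by simp)
  have hoff : (Finset.univ : Finset (Fin n)).offDiag =
      (Finset.univ.filter fun p : Fin n × Fin n => p.1 < p.2) ∪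
        Finset.univ.filter fun p : Fin n × Fin n => p.2 < p.1 := by
    ext p
    simp
  have hcard := Finset.offDiag_card (Finset.univ : Finset (Fin n))
  rw [hoff, Finset.card_union_of_disjoint, hswap, Finset.card_univ, Fintype.card_fin] at hcard
  · rw [two_mul, hcard, Nat.mul_sub_one]
  · exact Finset.disjoint_filter.2 fun p _ h => h.not_gt

theorem two_mul_invCount_add_noninversions {n : ℕ} (w : Equiv.Perm (Fin n)) :
    2 * (invCount w + (Finset.univ.filter fun p : Fin n × Fin n =>
      p.1 < p.2 ∧ w.symm p.1 < w.symm p.2).card) = n * (n - 1) := by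
  have hinv : invCount w = (Finset.univ.filter fun p : Fin n × Fin n =>
      p.1 < p.2 ∧ ¬ w.symm p.1 < w.symm p.2).card := by
    refine Finset.card_bij' (fun p _ => (w p.2, w p.1)) (fun p _ => (w.symm p.2, w.symm p.1))
      ?_ ?_ (by simp) (by simp)
    · simp only [Finset.mem_filter, Finset.mem_univ, true_and, Equiv.symm_apply_apply, not_lt]
      exact fun p hp => ⟨hp.2, hp.1.le⟩
    · simp only [Finset.mem_filter, Finset.mem_univ, true_and, Equiv.apply_symm_apply, not_lt]
      exact fun p hp => ⟨hp.2.lt_of_ne (w.symm.injective.ne hp.1.ne'), hp.1⟩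
  rw [← card_filter_fst_lt_snd, hinv, ← Finset.filter_filter, ← Finset.filter_filter,
    add_comm, Finset.card_filter_add_card_filter_not]

theorem card_filter_odd_Icc (s : ℕ) :
    ((Finset.Icc 1 (2 * s - 3)).filter fun i => Odd i).card = s - 1 := by
  rw [← Finset.card_range (s - 1)]
  refine Finset.card_bij' (fun i _ => i / 2) (fun k _ => 2 * k + 1) ?_ ?_ ?_ ?_ <;>
    simp only [Finset.mem_filter, Finset.mem_Icc, Finset.mem_range, Nat.odd_iff] <;> omega

theorem NoninversionsGivenBy.card_noninversions {A : Finset ℕ} {s : ℕ}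
    {w : Equiv.Perm (Fin (s * 2))} (h : NoninversionsGivenBy A w)
    (hA : A ⊆ (Finset.Icc 1 (2 * s - 3)).filter fun i => Odd i) :
    (Finset.univ.filter fun p : Fin (s * 2) × Fin (s * 2) =>
      p.1 < p.2 ∧ w.symm p.1 < w.symm p.2).card + A.card = s + (s - 1) := by
  let N₁ := Finset.univ.filter fun p : Fin (s * 2) × Fin (s * 2) =>
    (p.1 : ℕ) % 2 = 0 ∧ (p.2 : ℕ) = p.1 + 1
  let N₃ := Finset.univ.filter fun p : Fin (s * 2) × Fin (s * 2) =>
    (p.1 : ℕ) % 2 = 0 ∧ (p.2 : ℕ) = p.1 + 3 ∧ (p.1 : ℕ) + 1 ∉ A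
  have hN : (Finset.univ.filter fun p : Fin (s * 2) × Fin (s * 2) =>
      p.1 < p.2 ∧ w.symm p.1 < w.symm p.2) = N₁ ∪ N₃ := by
    ext ⟨a, b⟩
    simp only [N₁, N₃, Finset.mem_filter, Finset.mem_univ, true_and, Finset.mem_union]
    rw [and_congr_right fun hab => h a b hab, Fin.lt_def]
    constructor
    · rintro ⟨-, h₀, h₁ | h₃⟩
      exacts [Or.inl ⟨h₀, h₁⟩, Or.inr ⟨h₀, h₃⟩]
    · rintro (⟨h₀, h₁⟩ | ⟨h₀, h₃⟩)
      exacts [⟨by omega, h₀, Or.inl h₁⟩, ⟨by omega, h₀, Or.inr h₃⟩]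
  have hdisj : Disjoint N₁ N₃ := Finset.disjoint_filter.2 fun p _ h₁ h₃ => by omega
  have hN₁ : N₁.card = s := by
    refine Eq.trans ?_ (Finset.card_range s)
    refine Finset.card_bij (fun p _ => (p.1 : ℕ) / 2) ?_ ?_ ?_
    · intro p _
      have := p.1.isLt
      rw [Finset.mem_range]
      omega
    · intro p hp q hq hpq
      simp only [N₁, Finset.mem_filter] at hp hq
      exact Prod.ext (Fin.ext (by omega)) (Fin.ext (by omega))
    · intro k hk
      rw [Finset.mem_range] at hk
      exact ⟨(⟨2 * k, by omega⟩, ⟨2 * k + 1, by omega⟩), by simp [N₁], by simp⟩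
  have hN₃ : N₃.card = (((Finset.Icc 1 (2 * s - 3)).filter fun i => Odd i) \ A).card := by
    refine Finset.card_bij (fun p _ => (p.1 : ℕ) + 1) ?_ ?_ ?_
    · intro p hp
      have := p.2.isLt
      simp only [N₃, Finset.mem_filter] at hp
      simp only [Finset.mem_sdiff, Finset.mem_filter, Finset.mem_Icc, Nat.odd_iff]
      exact ⟨by omega, hp.2.2.2⟩
    · intro p hp q hq hpq
      simp only [N₃, Finset.mem_filter] at hp hq
      exact Prod.ext (Fin.ext (by omega)) (Fin.ext (by omega))
    · intro i hi
      simp only [Finset.mem_sdiff, Finset.mem_filter, Finset.mem_Icc, Nat.odd_iff] at hi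
      have hi₁ : i - 1 + 1 = i := by omega
      refine ⟨(⟨i - 1, by omega⟩, ⟨i + 2, by omega⟩), ?_, hi₁⟩
      simp only [N₃, Finset.mem_filter, Finset.mem_univ, true_and, hi₁]
      exact ⟨by omega, by omega, hi.2⟩
  rw [hN, Finset.card_union_of_disjoint hdisj, hN₁, hN₃, add_assoc,
    Finset.card_sdiff_add_card_eq_card hA, card_filter_odd_Icc]

/-- `η` is a bijection from `N_{s,2}(2143)` onto the collection of all subsets of
`{1,3,5,…,2s−3}`, and `inv(w) = (2s−1)(s−1) + |η(w)|` for every `w ∈ N_{s,2}(2143)`. -/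
theorem eta_bijective (s : ℕ) (hs : 1 ≤ s) :
    Function.Bijective
      (fun w : {w : Equiv.Perm (Fin (s * 2)) // IsLinExtN s 2 w ∧ ¬ PermContains w pat2143} =>
        (⟨eta s w.1, Finset.filter_subset _ _⟩ :
          {A : Finset ℕ // A ⊆ (Finset.Icc 1 (2 * s - 3)).filter fun i => Odd i})) ∧
    ∀ w : Equiv.Perm (Fin (s * 2)), IsLinExtN s 2 w → ¬ PermContains w pat2143 →
      invCount w = (2 * s - 1) * (s - 1) + (eta s w).card := by
  refine ⟨⟨?_, ?_⟩, ?_⟩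
  · rintro ⟨v, hv, hv'⟩ ⟨w, hw, hw'⟩ hvw
    have heta : eta s v = eta s w := congrArg Subtype.val hvw
    refine Subtype.ext ((hv.noninversionsGivenBy_eta hv').eq ?_)
    rw [heta]
    exact hw.noninversionsGivenBy_eta hw'
  · rintro ⟨A, hA⟩
    obtain ⟨w, hw⟩ := exists_noninversionsGivenBy s A
    exact ⟨⟨w, hw.isLinExtN, hw.not_permContains⟩, Subtype.ext (hw.eta_eq hA)⟩
  · intro w hw hw'
    have hcard := (hw.noninversionsGivenBy_eta hw').card_noninversions (Finset.filter_subset _ _)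
    have htotal := two_mul_invCount_add_noninversions w
    obtain ⟨r, rfl⟩ := Nat.exists_eq_add_of_le' hs
    rw [show (r + 1) * 2 - 1 = 2 * r + 1 by omega] at htotal
    rw [show 2 * (r + 1) - 1 = 2 * r + 1 by omega]
    rw [Nat.add_sub_cancel] at hcard ⊢
    nlinarith
end

section
/- For all integers s ≥ 2, N_{s,3}(2143)(q) = q^{9(s−1)−2}(1+q+q²)·N_{s−1,3}(2143)(q) + q^{9(s−1)−3}(1+q)·H_{s−1}(q) as polynomials in q. -/
open Polynomial

open Classical in
/-- `H_s(q) = Σ_{w ∈ H_s} q^{inv(w)}`, where `H_s` is the set of `w ∈ N_{s,3}(2143)` whose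
second entry `w_2` is the 1-indexed label `3s−1` (0-indexed: position `1` carries `3s−2`). -/
noncomputable def HsPoly (s : ℕ) : Polynomial ℤ :=
  ∑ w ∈ Finset.univ.filter
      (fun w : Equiv.Perm (Fin (s * 3)) => IsLinExtN s 3 w ∧ ¬ PermContains w pat2143 ∧
        ∀ p : Fin (s * 3), (p : ℕ) = 1 → (w p : ℕ) = 3 * s - 2),
    (X : Polynomial ℤ) ^ invCount w

/-- The word obtained from `u` by inserting a new maximal letter at position `p`. -/
def insertMax {n : ℕ} (p : Fin (n + 1)) (u : Equiv.Perm (Fin n)) : Equiv.Perm (Fin (n + 1)) :=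
  (finSuccEquiv' p).trans ((Equiv.optionCongr u).trans (finSuccEquiv' (Fin.last n)).symm)

lemma insertMax_self {n : ℕ} (p : Fin (n + 1)) (u : Equiv.Perm (Fin n)) :
    insertMax p u p = Fin.last n := by
  simp [insertMax]

lemma insertMax_succAbove {n : ℕ} (p : Fin (n + 1)) (u : Equiv.Perm (Fin n)) (k : Fin n) :
    insertMax p u (p.succAbove k) = (u k).castSucc := by
  simp [insertMax]

lemma insertMax_bijective (n : ℕ) :
    Function.Bijective
      (fun x : Fin (n + 1) × Equiv.Perm (Fin n) => insertMax x.1 x.2) := by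
  rw [Fintype.bijective_iff_injective_and_card]
  refine ⟨?_, by simp [Fintype.card_perm, Nat.factorial_succ]⟩
  rintro ⟨p, u⟩ ⟨p', u'⟩ h
  simp only at h
  have hp : p = p' := by
    apply (insertMax p' u').injective
    rw [insertMax_self, ← h, insertMax_self]
  subst hp
  have hu : u = u' := by
    ext k
    have := insertMax_succAbove p u k
    rw [h, insertMax_succAbove] at this
    simpa using (congrArg Fin.val this).symm
  rw [hu]

lemma invCount_eq_sum {n : ℕ} (w : Equiv.Perm (Fin n)) :
    invCount w = ∑ x, ∑ y, if x < y ∧ w y < w x then 1 else 0 := by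
  rw [invCount, Finset.card_filter, ← Finset.univ_product_univ, Finset.sum_product]

lemma sum_lt_succAbove {n : ℕ} (p : Fin (n + 1)) :
    (∑ k : Fin n, if p < p.succAbove k then 1 else 0) = n - (p : ℕ) := by
  have h : ∀ k : Fin n, p < p.succAbove k ↔ ¬ ((k : ℕ) < p) := by
    intro k
    rw [Fin.lt_succAbove_iff_le_castSucc, Fin.le_def]
    simp
  simp only [h]
  rw [Fin.sum_univ_eq_sum_range (fun k => if ¬ (k < (p : ℕ)) then 1 else 0) n,
    ← Finset.card_filter]
  have : (Finset.range n).filter (fun k => ¬ k < (p : ℕ)) = Finset.Ico (p : ℕ) n := by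
    ext k
    simp only [Finset.mem_filter, Finset.mem_range, Finset.mem_Ico]
    omega
  rw [this, Nat.card_Ico]

lemma invCount_insertMax {n : ℕ} (p : Fin (n + 1)) (u : Equiv.Perm (Fin n)) :
    invCount (insertMax p u) = invCount u + (n - (p : ℕ)) := by
  rw [invCount_eq_sum, invCount_eq_sum, Fin.sum_univ_succAbove _ p,
    Fin.sum_univ_succAbove _ p]
  simp only [Fin.sum_univ_succAbove _ p, insertMax_self, insertMax_succAbove,
    Fin.castSucc_lt_last, Fin.castSucc_lt_castSucc_iff, Fin.succAbove_lt_succAbove_iff, and_true,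
    lt_irrefl, false_and, if_false, zero_add, sum_lt_succAbove]
  have : ∀ k : Fin n, ¬ Fin.last n < (u k).castSucc := fun k => not_lt.2 (Fin.le_last _)
  simp only [this, and_false, if_false, zero_add]
  omega

lemma sum_perm_succ {M : Type*} [AddCommMonoid M] (n : ℕ)
    (f : Equiv.Perm (Fin (n + 1)) → M) :
    ∑ w, f w = ∑ p : Fin (n + 1), ∑ u : Equiv.Perm (Fin n), f (insertMax p u) := by
  rw [← Fintype.sum_prod_type' (f := fun p u => f (insertMax p u))]
  exact ((insertMax_bijective n).sum_comp f).symm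

/-- Linear extensions of a poset with three columns, described by the positions of the letters. -/
def IsThreeColumnExt {n : ℕ} (w : Equiv.Perm (Fin n)) : Prop :=
  ∀ x y : Fin n, ((w y : ℕ) = w x + 1 → ¬ 3 ∣ ((w x : ℕ) + 1) → x < y) ∧
    ((w y : ℕ) + 3 = w x → x < y)

lemma isLinExtN_three_iff {s : ℕ} (w : Equiv.Perm (Fin (s * 3))) :
    IsLinExtN s 3 w ↔ IsThreeColumnExt w := by
  constructor
  · rintro ⟨h1, h2⟩ x y
    exact ⟨fun h h' => by simpa using h1 (w x) (w y) h h',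
      fun h => by simpa using h2 (w x) (w y) h⟩
  · intro h
    exact ⟨fun a b hab hd => (h (w.symm a) (w.symm b)).1 (by simpa using hab) (by simpa using hd),
      fun a b hab => (h (w.symm a) (w.symm b)).2 (by simpa using hab)⟩

/-- Containment of `2143`, spelled out on the four positions. -/
lemma permContains_pat2143_iff {n : ℕ} (w : Equiv.Perm (Fin n)) :
    PermContains w pat2143 ↔ ∃ a b c d : Fin n, a < b ∧ b < c ∧ c < d ∧
      w b < w a ∧ w a < w d ∧ w d < w c := by
  constructor
  · rintro ⟨f, hf, h⟩
    exact ⟨f 0, f 1, f 2, f 3, hf (by decide), hf (by decide), hf (by decide),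
      (h 1 0).2 (by decide), (h 0 3).2 (by decide), (h 3 2).2 (by decide)⟩
  · rintro ⟨a, b, c, d, hab, hbc, hcd, h1, h2, h3⟩
    refine ⟨![a, b, c, d], ?_, ?_⟩
    · rw [Fin.strictMono_iff_lt_succ]
      intro i
      fin_cases i
      exacts [hab, hbc, hcd]
    · have key : ∀ j k : Fin 4, pat2143 j < pat2143 k →
          w (![a, b, c, d] j) < w (![a, b, c, d] k) := by
        intro j k
        fin_cases j <;> fin_cases k <;> simp [pat2143] <;> grind
      intro j k
      refine ⟨fun hjk => ?_, key j k⟩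
      by_contra hn
      rcases (not_lt.1 hn).lt_or_eq with h | h
      · exact absurd (key k j h) (not_lt.2 hjk.le)
      · rw [pat2143.injective h] at hjk
        exact lt_irrefl _ hjk

lemma exists_position {n : ℕ} (w : Equiv.Perm (Fin n)) {v : ℕ} (hv : v < n) :
    ∃ k, (w k : ℕ) = v :=
  ⟨w.symm ⟨v, hv⟩, by simp⟩

lemma IsThreeColumnExt.apply_zero {n : ℕ} {w : Equiv.Perm (Fin n)} (hw : IsThreeColumnExt w)
    (hn : 3 ∣ n) (z : Fin n) (hz : (z : ℕ) = 0) : (w z : ℕ) + 3 = n := by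
  have hlt := (w z).isLt
  by_cases h : (w z : ℕ) + 3 < n
  · obtain ⟨k, hk⟩ := exists_position w h
    have := (hw k z).2 hk.symm
    rw [Fin.lt_def] at this
    omega
  · by_contra hne
    obtain ⟨k, hk⟩ := exists_position w (v := (w z : ℕ) - 1) (by omega)
    have := (hw k z).1 (by omega) (by omega)
    rw [Fin.lt_def] at this
    omega

/-- Linear extensions avoiding `2143`. -/
def IsAvoidingExt {n : ℕ} (w : Equiv.Perm (Fin n)) : Prop :=
  IsThreeColumnExt w ∧ ¬ PermContains w pat2143

/-- Insert three new maximal letters, in increasing order of size. -/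
def insertThree {n : ℕ} (t : Fin (n + 3) × Fin (n + 2) × Fin (n + 1)) (u : Equiv.Perm (Fin n)) :
    Equiv.Perm (Fin (n + 3)) :=
  insertMax t.1 (insertMax t.2.1 (insertMax t.2.2 u))

/-- The position in `insertThree t u` of the letter at position `k` of `u`. -/
def shiftThree {n : ℕ} (t : Fin (n + 3) × Fin (n + 2) × Fin (n + 1)) (k : Fin n) : Fin (n + 3) :=
  t.1.succAbove (t.2.1.succAbove (t.2.2.succAbove k))

section

variable {n : ℕ} (t : Fin (n + 3) × Fin (n + 2) × Fin (n + 1)) (u : Equiv.Perm (Fin n))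

lemma insertThree_shiftThree (k : Fin n) :
    (insertThree t u (shiftThree t k) : ℕ) = u k := by
  simp [insertThree, shiftThree, insertMax_succAbove]

lemma insertThree_fst : (insertThree t u t.1 : ℕ) = n + 2 := by
  simp [insertThree, insertMax_self]

lemma insertThree_snd : (insertThree t u (t.1.succAbove t.2.1) : ℕ) = n + 1 := by
  simp [insertThree, insertMax_self, insertMax_succAbove]

lemma insertThree_third :
    (insertThree t u (t.1.succAbove (t.2.1.succAbove t.2.2)) : ℕ) = n := by
  simp [insertThree, insertMax_self, insertMax_succAbove]

lemma shiftThree_lt_iff {k l : Fin n} : shiftThree t k < shiftThree t l ↔ k < l := by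
  simp [shiftThree]

lemma exists_shiftThree {x : Fin (n + 3)} (hx : (insertThree t u x : ℕ) < n) :
    ∃ k, shiftThree t k = x := by
  obtain ⟨k, hk⟩ := exists_position u hx
  refine ⟨k, (insertThree t u).injective (Fin.ext ?_)⟩
  rw [insertThree_shiftThree, hk]

lemma val_succAbove {m : ℕ} (p : Fin (m + 1)) (k : Fin m) :
    (p.succAbove k : ℕ) = if (k : ℕ) < p then (k : ℕ) else k + 1 := by
  simp only [Fin.succAbove, Fin.lt_def, Fin.val_castSucc]
  split_ifs <;> simp

variable {t u}

lemma IsThreeColumnExt.of_insertThree (h : IsThreeColumnExt (insertThree t u)) :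
    IsThreeColumnExt u := by
  intro x y
  have := h (shiftThree t x) (shiftThree t y)
  simpa only [insertThree_shiftThree, shiftThree_lt_iff] using this

lemma permContains_insertThree (h : PermContains u pat2143) :
    PermContains (insertThree t u) pat2143 := by
  rw [permContains_pat2143_iff] at h ⊢
  obtain ⟨a, b, c, d, h⟩ := h
  refine ⟨shiftThree t a, shiftThree t b, shiftThree t c, shiftThree t d, ?_⟩
  simpa only [Fin.lt_def (a := insertThree t u _), insertThree_shiftThree, shiftThree_lt_iff,
    ← Fin.lt_def (a := u _)] using h

/-- The admissible positions for the three new letters. -/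
def AdmissibleTriple (t : Fin (n + 3) × Fin (n + 2) × Fin (n + 1)) (u : Equiv.Perm (Fin n)) :
    Prop :=
  (t.2.2 : ℕ) = 0 ∧ 1 ≤ (t.2.1 : ℕ) ∧ (t.2.1 : ℕ) ≤ 2 ∧ (t.2.1 : ℕ) < t.1 ∧ (t.1 : ℕ) ≤ 4 ∧
    ((t.1 : ℕ) = 4 → ∀ k : Fin n, (k : ℕ) = 1 → (u k : ℕ) + 2 = n)

lemma IsAvoidingExt.admissibleTriple (hn : 3 ∣ n) (hn3 : 3 ≤ n)
    (h : IsAvoidingExt (insertThree t u)) : AdmissibleTriple t u := by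
  obtain ⟨hw, hav⟩ := h
  have hu := hw.of_insertThree
  have hBC := (hw (t.1.succAbove t.2.1) t.1).1
    (by rw [insertThree_fst, insertThree_snd]) (by rw [insertThree_snd]; omega)
  have hAB := (hw (t.1.succAbove (t.2.1.succAbove t.2.2)) (t.1.succAbove t.2.1)).1
    (by rw [insertThree_third, insertThree_snd]) (by rw [insertThree_third]; omega)
  have hA : (t.1.succAbove (t.2.1.succAbove t.2.2) : ℕ) = 0 := by
    have h0 := hw.apply_zero (by omega) 0 rfl
    have : t.1.succAbove (t.2.1.succAbove t.2.2) = 0 :=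
      (insertThree t u).injective (Fin.ext (by rw [insertThree_third]; omega))
    rw [this]; rfl
  rw [Fin.lt_def] at hBC hAB
  have hshift : ∀ k, (shiftThree t k : ℕ) = _ := fun k => val_succAbove _ _
  simp only [val_succAbove] at hBC hAB hA hshift
  have hp3 : (t.2.2 : ℕ) = 0 := by split_ifs at hA; assumption
  have hp12 : (t.2.1 : ℕ) < t.1 := by split_ifs at hBC <;> omega
  have hp23 : 1 ≤ (t.2.1 : ℕ) := by
    simp only [hp3, hp12] at hAB
    split_ifs at hAB <;> omega
  have hu0 := hu.apply_zero hn ⟨0, by omega⟩ rfl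
  obtain ⟨m, hm⟩ := exists_position u (v := n - 1) (by omega)
  have hCm : t.1 < shiftThree t m :=
    (hw _ _).2 (by rw [insertThree_shiftThree, insertThree_fst]; omega)
  obtain ⟨b, hb⟩ := exists_position u (v := n - 2) (by omega)
  have hBb : t.1.succAbove t.2.1 < shiftThree t b :=
    (hw _ _).2 (by rw [insertThree_shiftThree, insertThree_snd]; omega)
  -- letters of `u` before the new maximum are large
  have hlarge : ∀ k : Fin n, 1 ≤ (k : ℕ) → shiftThree t k < t.1 → (u k : ℕ) + 2 = n := by
    intro k hk hkC
    have hne0 : (u k : ℕ) ≠ u ⟨0, by omega⟩ := by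
      intro he
      have := u.injective (Fin.ext he)
      rw [this] at hk
      simp at hk
    have hnem : (u k : ℕ) ≠ u m := by
      intro he
      rw [u.injective (Fin.ext he)] at hkC
      exact lt_asymm hkC hCm
    by_contra hne
    have hlt := (u k).isLt
    apply hav
    rw [permContains_pat2143_iff]
    refine ⟨shiftThree t ⟨0, by omega⟩, shiftThree t k, t.1, shiftThree t m, ?_, hkC, hCm, ?_⟩
    · rw [shiftThree_lt_iff, Fin.lt_def]; exact hk
    · simp only [Fin.lt_def, insertThree_shiftThree, insertThree_fst]
      omega
  have h1 : 4 ≤ (t.1 : ℕ) → (u ⟨1, by omega⟩ : ℕ) + 2 = n := by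
    intro h4
    refine hlarge _ le_rfl ?_
    rw [Fin.lt_def, hshift]
    simp only [hp3]
    split_ifs <;> omega
  refine ⟨hp3, hp23, ?_, hp12, ?_, ?_⟩
  · by_contra h3
    have hb1 : b = ⟨1, by omega⟩ := u.injective (Fin.ext (by have := h1 (by omega); omega))
    rw [Fin.lt_def, hshift, val_succAbove, hb1] at hBb
    simp only [hp3] at hBb
    split_ifs at hBb <;> omega
  · by_contra h5
    have h2 : (u ⟨2, by omega⟩ : ℕ) + 2 = n := by
      refine hlarge _ (by simp) ?_
      rw [Fin.lt_def, hshift]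
      simp only [hp3]
      split_ifs <;> omega
    have := u.injective (Fin.ext (h2.trans (h1 (by omega)).symm |> Nat.add_right_cancel))
    simp at this
  · intro h4 k hk
    rw [show k = ⟨1, by omega⟩ from Fin.ext hk]
    exact h1 h4.ge

lemma AdmissibleTriple.isAvoidingExt (hn : 3 ∣ n) (hn3 : 3 ≤ n) (ht : AdmissibleTriple t u)
    (hu : IsAvoidingExt u) : IsAvoidingExt (insertThree t u) := by
  obtain ⟨hp3, hp23, hB2, hp12, hC4, hH⟩ := ht
  obtain ⟨hu, hav⟩ := hu
  have hu0 := hu.apply_zero hn ⟨0, by omega⟩ rfl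
  have hshift : ∀ k, (shiftThree t k : ℕ) = _ := fun k => val_succAbove _ _
  simp only [val_succAbove, hp3] at hshift
  have hA : (t.1.succAbove (t.2.1.succAbove t.2.2) : ℕ) = 0 := by
    simp only [val_succAbove, hp3]; split_ifs <;> omega
  have hB : (t.1.succAbove t.2.1 : ℕ) = t.2.1 := by
    simp only [val_succAbove]; rw [if_pos hp12]
  have hposA : ∀ x, (insertThree t u x : ℕ) = n → (x : ℕ) = 0 := fun x hx => by
    rw [(insertThree t u).injective (Fin.ext (hx.trans (insertThree_third t u).symm)), hA]
  have hposB : ∀ x, (insertThree t u x : ℕ) = n + 1 → (x : ℕ) = t.2.1 := fun x hx => by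
    rw [(insertThree t u).injective (Fin.ext (hx.trans (insertThree_snd t u).symm)), hB]
  have hposC : ∀ x, (insertThree t u x : ℕ) = n + 2 → (x : ℕ) = t.1 := fun x hx => by
    rw [(insertThree t u).injective (Fin.ext (hx.trans (insertThree_fst t u).symm))]
  have hold : ∀ x, (insertThree t u x : ℕ) < n →
      ∃ k : Fin n, shiftThree t k = x ∧ (u k : ℕ) = insertThree t u x := by
    intro x hx
    obtain ⟨k, rfl⟩ := exists_shiftThree t u hx
    exact ⟨k, rfl, (insertThree_shiftThree t u k).symm⟩
  have hbig : ∀ x, ¬ (insertThree t u x : ℕ) < n →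
      ((insertThree t u x : ℕ) = n ∧ (x : ℕ) = 0) ∨
      ((insertThree t u x : ℕ) = n + 1 ∧ (x : ℕ) = t.2.1) ∨
      ((insertThree t u x : ℕ) = n + 2 ∧ (x : ℕ) = t.1) := by
    intro x hx
    have := (insertThree t u x).isLt
    rcases (by omega : (insertThree t u x : ℕ) = n ∨ (insertThree t u x : ℕ) = n + 1 ∨
      (insertThree t u x : ℕ) = n + 2) with h | h | h
    · exact .inl ⟨h, hposA x h⟩
    · exact .inr (.inl ⟨h, hposB x h⟩)
    · exact .inr (.inr ⟨h, hposC x h⟩)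
  -- a letter of `u` at position `k ≥ 1`, or `k ≥ 2`, is far enough to the right
  have hpos1 : ∀ k : Fin n, (u k : ℕ) + 2 = n ∨ (u k : ℕ) + 1 = n → 1 ≤ (k : ℕ) := by
    intro k hk
    by_contra h0
    rw [show k = ⟨0, by omega⟩ from Fin.ext (by simp; omega)] at hk
    omega
  have hpos2 : ∀ k : Fin n, (u k : ℕ) + 1 = n → (t.1 : ℕ) = 4 → 2 ≤ (k : ℕ) := by
    intro k hk h4
    have h1 := hpos1 k (.inr hk)
    by_contra h2
    have := hH h4 k (by omega)
    omega
  constructor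
  · intro x y
    by_cases hx : (insertThree t u x : ℕ) < n
    · obtain ⟨k, rfl, hk⟩ := hold x hx
      by_cases hy : (insertThree t u y : ℕ) < n
      · obtain ⟨l, rfl, hl⟩ := hold y hy
        rw [← hk, ← hl, shiftThree_lt_iff]
        exact hu k l
      · refine ⟨fun h hd => absurd ?_ hd, fun h => ?_⟩
        · rw [show (insertThree t u (shiftThree t k) : ℕ) + 1 = n by omega]; exact hn
        · omega
    · have hxb := hbig x hx
      rw [Fin.lt_def]
      by_cases hy : (insertThree t u y : ℕ) < n
      · obtain ⟨l, rfl, hl⟩ := hold y hy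
        refine ⟨fun h => by omega, fun h => ?_⟩
        have h1 := hpos1 l
        have h2 := hpos2 l
        rw [hshift]
        rcases hxb with ⟨h, h'⟩ | ⟨h, h'⟩ | ⟨h, h'⟩ <;> split_ifs <;> omega
      · have hyb := hbig y hy
        refine ⟨fun h _ => ?_, fun h => ?_⟩ <;> omega
  · rw [permContains_pat2143_iff]
    rintro ⟨a, b, c, d, hab, hbc, hcd, h1, h2, h3⟩
    rw [Fin.lt_def] at h1 h2 h3
    have hd : (insertThree t u d : ℕ) < n := by
      by_contra hd
      have hdb := hbig d hd
      have hcb := hbig c (by omega)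
      rw [Fin.lt_def] at hcd
      omega
    obtain ⟨l, rfl, hl⟩ := hold d hd
    obtain ⟨i, rfl, hi⟩ := hold a (by omega)
    obtain ⟨j, rfl, hj⟩ := hold b (by omega)
    rw [shiftThree_lt_iff] at hab
    by_cases hc : (insertThree t u c : ℕ) < n
    · obtain ⟨k, rfl, hk⟩ := hold c hc
      rw [shiftThree_lt_iff] at hbc hcd
      apply hav
      rw [permContains_pat2143_iff]
      refine ⟨i, j, k, l, hab, hbc, hcd, ?_⟩
      simp only [Fin.lt_def]
      omega
    · have hcb := hbig c hc
      rw [Fin.lt_def] at hab hbc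
      rw [hshift] at hbc
      have hj1 : (j : ℕ) = 1 ∧ (t.1 : ℕ) = 4 := by
        split_ifs at hbc <;> omega
      have hi0 : i = ⟨0, by omega⟩ := Fin.ext (by simp; omega)
      have := hH hj1.2 j hj1.1
      rw [hi0] at hi
      rw [hi0] at h1
      omega

lemma isAvoidingExt_insertThree_iff (hn : 3 ∣ n) (hn3 : 3 ≤ n) :
    IsAvoidingExt (insertThree t u) ↔ IsAvoidingExt u ∧ AdmissibleTriple t u :=
  ⟨fun h => ⟨⟨h.1.of_insertThree, fun hc => h.2 (permContains_insertThree hc)⟩,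
    h.admissibleTriple hn hn3⟩, fun h => h.2.isAvoidingExt hn hn3 h.1⟩

lemma AdmissibleTriple.invCount_insertThree (ht : AdmissibleTriple t u) :
    invCount (insertThree t u) + t.1 + t.2.1 = invCount u + 3 * n + 3 := by
  obtain ⟨h1, h2, h3, h4, h5, -⟩ := ht
  have := t.1.isLt
  have := t.2.1.isLt
  rw [insertThree, invCount_insertMax, invCount_insertMax, invCount_insertMax]
  omega

end

open Classical in
lemma sum_admissibleTriple {n : ℕ} (hn3 : 3 ≤ n) (u : Equiv.Perm (Fin n)) :
    (∑ t : Fin (n + 3) × Fin (n + 2) × Fin (n + 1), if AdmissibleTriple t u then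
      (X : ℤ[X]) ^ invCount (insertThree t u) else 0) =
    X ^ (3 * n - 2) * (1 + X + X ^ 2) * X ^ invCount u +
      if ∀ k : Fin n, (k : ℕ) = 1 → (u k : ℕ) + 2 = n then
        X ^ (3 * n - 3) * (1 + X) * X ^ invCount u else 0 := by
  obtain ⟨m, rfl⟩ := Nat.exists_eq_add_of_le hn3
  have hinv : ∀ t, (if AdmissibleTriple t u then (X : ℤ[X]) ^ invCount (insertThree t u) else 0) =
      if AdmissibleTriple t u then
        X ^ (invCount u + 3 * (3 + m) + 3 - (t.1 : ℕ) - (t.2.1 : ℕ)) else 0 := by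
    intro t
    split_ifs with h
    · have := h.invCount_insertThree
      congr 1
      omega
    · rfl
  simp only [hinv]
  rw [← Finset.sum_filter]
  let τ : ∀ (i j : ℕ) (_ : i < 5 := by decide) (_ : j < 3 := by decide),
      Fin (3 + m + 3) × Fin (3 + m + 2) × Fin (3 + m + 1) :=
    fun i j _ _ => (⟨i, by omega⟩, ⟨j, by omega⟩, ⟨0, by omega⟩)
  by_cases hH : ∀ k : Fin (3 + m), (k : ℕ) = 1 → (u k : ℕ) + 2 = 3 + m
  · have hset : Finset.univ.filter (fun t => AdmissibleTriple t u) =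
        {τ 2 1, τ 3 1, τ 3 2, τ 4 1, τ 4 2} := by
      ext ⟨a, b, c⟩
      rw [Finset.mem_filter_univ]
      simp only [AdmissibleTriple, iff_true_intro hH, implies_true, and_true,
        Finset.mem_insert, Finset.mem_singleton, τ,
        Prod.mk.injEq, Fin.ext_iff]
      omega
    rw [hset, if_pos hH]
    rw [Finset.sum_insert, Finset.sum_insert, Finset.sum_insert, Finset.sum_insert,
      Finset.sum_singleton]
    · simp only [τ]
      have e1 : invCount u + 3 * (3 + m) + 3 - 2 - 1 = 6 + 3 * m + 3 + invCount u := by omega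
      have e2 : invCount u + 3 * (3 + m) + 3 - 3 - 1 = 6 + 3 * m + 2 + invCount u := by omega
      have e3 : invCount u + 3 * (3 + m) + 3 - 3 - 2 = 6 + 3 * m + 1 + invCount u := by omega
      have e4 : invCount u + 3 * (3 + m) + 3 - 4 - 1 = 6 + 3 * m + 1 + invCount u := by omega
      have e5 : invCount u + 3 * (3 + m) + 3 - 4 - 2 = 6 + 3 * m + invCount u := by omega
      have e6 : 3 * (3 + m) - 2 = 6 + 3 * m + 1 := by omega
      have e7 : 3 * (3 + m) - 3 = 6 + 3 * m := by omega
      rw [e1, e2, e3, e4, e5, e6, e7]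
      ring
    all_goals simp [τ]
  · have hset : Finset.univ.filter (fun t => AdmissibleTriple t u) =
        {τ 2 1, τ 3 1, τ 3 2} := by
      ext ⟨a, b, c⟩
      rw [Finset.mem_filter_univ]
      simp only [AdmissibleTriple, hH, imp_false, Finset.mem_insert, Finset.mem_singleton, τ,
        Prod.mk.injEq, Fin.ext_iff]
      omega
    rw [hset, if_neg hH]
    rw [Finset.sum_insert, Finset.sum_insert, Finset.sum_singleton]
    · simp only [τ]
      have e1 : invCount u + 3 * (3 + m) + 3 - 2 - 1 = 6 + 3 * m + 3 + invCount u := by omega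
      have e2 : invCount u + 3 * (3 + m) + 3 - 3 - 1 = 6 + 3 * m + 2 + invCount u := by omega
      have e3 : invCount u + 3 * (3 + m) + 3 - 3 - 2 = 6 + 3 * m + 1 + invCount u := by omega
      have e6 : 3 * (3 + m) - 2 = 6 + 3 * m + 1 := by omega
      rw [e1, e2, e3, e6]
      ring
    all_goals simp [τ]

open Classical in
lemma sum_isAvoidingExt_add_three {n : ℕ} (hn : 3 ∣ n) (hn3 : 3 ≤ n) :
    (∑ w : Equiv.Perm (Fin (n + 3)), if IsAvoidingExt w then (X : ℤ[X]) ^ invCount w else 0) =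
    X ^ (3 * n - 2) * (1 + X + X ^ 2) *
        (∑ u : Equiv.Perm (Fin n), if IsAvoidingExt u then (X : ℤ[X]) ^ invCount u else 0) +
      X ^ (3 * n - 3) * (1 + X) *
        ∑ u : Equiv.Perm (Fin n), if IsAvoidingExt u ∧
          ∀ k : Fin n, (k : ℕ) = 1 → (u k : ℕ) + 2 = n then (X : ℤ[X]) ^ invCount u else 0 := by
  have hsum : (∑ w : Equiv.Perm (Fin (n + 3)),
      if IsAvoidingExt w then (X : ℤ[X]) ^ invCount w else 0) =
      ∑ t : Fin (n + 3) × Fin (n + 2) × Fin (n + 1), ∑ u : Equiv.Perm (Fin n),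
        if IsAvoidingExt (insertThree t u) then (X : ℤ[X]) ^ invCount (insertThree t u) else 0 := by
    rw [Fintype.sum_prod_type, sum_perm_succ]
    refine Finset.sum_congr rfl fun a _ => ?_
    rw [Fintype.sum_prod_type, sum_perm_succ]
    refine Finset.sum_congr rfl fun b _ => ?_
    rw [sum_perm_succ]
    rfl
  rw [hsum, Finset.sum_comm, Finset.mul_sum, Finset.mul_sum, ← Finset.sum_add_distrib]
  refine Finset.sum_congr rfl fun u _ => ?_
  simp only [isAvoidingExt_insertThree_iff hn hn3]
  by_cases hu : IsAvoidingExt u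
  · simp only [hu, true_and, if_true, sum_admissibleTriple hn3, mul_ite, mul_zero]
  · simp [hu]

open Classical in
lemma NPoly_three_eq_sum {s n : ℕ} (h : s * 3 = n) :
    NPoly s 3 pat2143 =
      ∑ w : Equiv.Perm (Fin n), if IsAvoidingExt w then (X : ℤ[X]) ^ invCount w else 0 := by
  subst h
  rw [NPoly, Finset.sum_filter]
  refine Finset.sum_congr rfl fun w _ => if_congr ?_ rfl rfl
  rw [isLinExtN_three_iff, IsAvoidingExt]

open Classical in
lemma HsPoly_eq_sum {s : ℕ} (hs : 1 ≤ s) :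
    HsPoly s = ∑ w : Equiv.Perm (Fin (s * 3)), if IsAvoidingExt w ∧
      ∀ k : Fin (s * 3), (k : ℕ) = 1 → (w k : ℕ) + 2 = s * 3 then
        (X : ℤ[X]) ^ invCount w else 0 := by
  have h : ∀ v : ℕ, v = 3 * s - 2 ↔ v + 2 = s * 3 := by omega
  rw [HsPoly, Finset.sum_filter]
  simp only [isLinExtN_three_iff, IsAvoidingExt, and_assoc, h]

/-- **Equation (2).** For `s ≥ 2`,
`N_{s,3}(2143)(q) = q^{9(s−1)−2}(1+q+q²) N_{s−1,3}(2143)(q) + q^{9(s−1)−3}(1+q) H_{s−1}(q)`. -/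
theorem NPoly_s_three_recurrence (s : ℕ) (hs : 2 ≤ s) :
    NPoly s 3 pat2143 =
      X ^ (9 * (s - 1) - 2) * (1 + X + X ^ 2) * NPoly (s - 1) 3 pat2143 +
        X ^ (9 * (s - 1) - 3) * (1 + X) * HsPoly (s - 1) := by
  rw [NPoly_three_eq_sum (show s * 3 = (s - 1) * 3 + 3 by omega), NPoly_three_eq_sum rfl,
    HsPoly_eq_sum (by omega), sum_isAvoidingExt_add_three (Dvd.intro_left _ rfl) (by omega),
    show 3 * ((s - 1) * 3) = 9 * (s - 1) by ring]
end

section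
/- Let a_s denote the number of linear extensions of N_{s,3} that avoid the pattern 2143. Then a_1 = 1, a_2 = 5, and a_s = 4a_{s−1} + a_{s−2} for all s ≥ 3. -/
open Polynomial

/-- `MustPrecede a b`: the label `a` has to appear before the label `b` in every `2143`-avoiding
linear extension of `N_{s,3}`. Beyond the two relations of the poset, the largest label of a row
has to precede the smallest label two rows further down. -/
def MustPrecede (a b : ℕ) : Prop :=
  (b = a + 1 ∧ ¬ 3 ∣ a + 1) ∨ b + 3 = a ∨ (a = b + 8 ∧ 3 ∣ b)

open Classical in
/-- The orderings of `S`, as lists, that respect the constraints `R a b`, read as `a` before `b`. -/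
noncomputable def linExts {α : Type*} (R : α → α → Prop) (S : Finset α) : Finset (List α) :=
  S.val.lists.toFinset.filter fun l => l.Pairwise fun x y => ¬ R y x

theorem mem_linExts {α : Type*} {R : α → α → Prop} {S : Finset α} {l : List α} :
    l ∈ linExts R S ↔ S.val = (l : Multiset α) ∧ l.Pairwise fun x y => ¬ R y x := by
  simp [linExts, Multiset.mem_lists_iff]

open Classical in
/-- Counting the orderings by their first entry. -/
theorem card_linExts {α : Type*} (R : α → α → Prop) (S : Finset α) (hS : S.Nonempty)
    (M : Finset α) (hR : ∀ x, ¬ R x x)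
    (hM : ∀ x, x ∈ M ↔ x ∈ S ∧ ∀ y ∈ S, ¬ R y x) :
    (linExts R S).card = ∑ x ∈ M, (linExts R (S.erase x)).card := by
  have key : linExts R S = M.biUnion fun x => (linExts R (S.erase x)).image (List.cons x) := by
    ext l
    simp only [Finset.mem_biUnion, Finset.mem_image, mem_linExts, Finset.erase_val]
    constructor
    · rintro ⟨h, hp⟩
      cases l with
      | nil =>
        obtain ⟨x, hx⟩ := hS
        rw [← Finset.mem_val, h] at hx
        simp at hx
      | cons x t =>
        have hp' := List.pairwise_cons.1 hp
        have hmem : ∀ y, y ∈ S ↔ y = x ∨ y ∈ t := fun y => by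
          rw [← Finset.mem_val, h]; simp
        refine ⟨x, (hM x).2 ⟨(hmem x).2 (Or.inl rfl), fun y hy => ?_⟩, t, ⟨?_, hp'.2⟩, rfl⟩
        · rcases (hmem y).1 hy with rfl | hy
          · exact hR _
          · exact hp'.1 y hy
        · rw [h, ← Multiset.cons_coe, Multiset.erase_cons_head]
    · rintro ⟨x, hx, t, ⟨h, hp⟩, rfl⟩
      obtain ⟨hxS, hmin⟩ := (hM x).1 hx
      refine ⟨?_, List.pairwise_cons.2 ⟨fun y hy => hmin y ?_, hp⟩⟩
      · rw [← Multiset.cons_coe, ← h, Multiset.cons_erase hxS]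
      · have : y ∈ S.val.erase x := by rw [h]; simpa using hy
        exact Multiset.mem_of_mem_erase this
  rw [key, Finset.card_biUnion]
  · exact Finset.sum_congr rfl fun x _ =>
      Finset.card_image_of_injective _ List.cons_injective
  · intro x _ y _ hxy
    rw [Function.onFun, Finset.disjoint_left]
    intro l hl hl'
    obtain ⟨t, -, rfl⟩ := Finset.mem_image.1 hl
    obtain ⟨t', -, h⟩ := Finset.mem_image.1 hl'
    exact hxy (List.cons.inj h).1.symm

/-- The labels left over once `p` labels of row `r + 1` and `q` labels of row `r` have been
used, rows being numbered from the smallest labels. -/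
def remaining (r p q : ℕ) : Finset ℕ :=
  (Finset.range (3 * r + 6)).filter fun x =>
    x < 3 * r ∨ (3 * r + q ≤ x ∧ x < 3 * r + 3) ∨ 3 * r + 3 + p ≤ x

/-- The labels left over once `q` labels of row `r`, the top row, have been used. -/
def remainingTop (r q : ℕ) : Finset ℕ :=
  (Finset.range (3 * r + 3)).filter fun x => x < 3 * r ∨ 3 * r + q ≤ x

theorem remaining_three (r q : ℕ) : remaining r 3 q = remainingTop r q := by
  ext x
  simp only [remaining, remainingTop, Finset.mem_filter, Finset.mem_range]
  omega

theorem remaining_zero (r p : ℕ) : remaining r p 0 = remainingTop (r + 1) p := by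
  ext x
  simp only [remaining, remainingTop, Finset.mem_filter, Finset.mem_range]
  omega

theorem mustPrecede_irrefl (x : ℕ) : ¬ MustPrecede x x := by
  unfold MustPrecede
  omega

theorem minimal_remaining {r p q x : ℕ} (hp : p < 3) (hq : q ≤ p) :
    (x ∈ remaining r p q ∧ ∀ y ∈ remaining r p q, ¬ MustPrecede y x) ↔
      x = 3 * r + 3 + p ∨ (x = 3 * r + q ∧ q < p) := by
  simp only [remaining, Finset.mem_filter, Finset.mem_range, MustPrecede]
  constructor
  · rintro ⟨hx, h⟩
    have h1 := h (x - 1)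
    have h2 := h (x + 3)
    have h3 := h (x + 8)
    have h4 := h (x + 6)
    omega
  · intro hx
    refine ⟨by omega, fun y hy => ?_⟩
    omega

theorem card_linExts_remaining_of_lt {r p q : ℕ} (hp : p < 3) (hq : q < p) :
    (linExts MustPrecede (remaining r p q)).card =
      (linExts MustPrecede (remaining r (p + 1) q)).card +
        (linExts MustPrecede (remaining r p (q + 1))).card := by
  rw [card_linExts _ _ ⟨3 * r + 3 + p, by simp [remaining]; omega⟩ {3 * r + 3 + p, 3 * r + q}
    mustPrecede_irrefl]
  · rw [Finset.sum_pair (by omega)]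
    congr 3 <;> ext x <;>
      simp only [remaining, Finset.mem_erase, Finset.mem_filter, Finset.mem_range] <;> omega
  · intro x
    rw [minimal_remaining hp hq.le]
    simp [hq]

theorem card_linExts_remaining_self {r p : ℕ} (hp : p < 3) :
    (linExts MustPrecede (remaining r p p)).card =
      (linExts MustPrecede (remaining r (p + 1) p)).card := by
  rw [card_linExts _ _ ⟨3 * r + 3 + p, by simp [remaining]; omega⟩ {3 * r + 3 + p}
    mustPrecede_irrefl]
  · rw [Finset.sum_singleton]
    congr 2
    ext x
    simp only [remaining, Finset.mem_erase, Finset.mem_filter, Finset.mem_range]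
    omega
  · intro x
    rw [minimal_remaining hp le_rfl]
    simp

/-- The number of admissible continuations once `q` labels of the top row `r` have been used. -/
noncomputable def topCount (r q : ℕ) : ℕ :=
  (linExts MustPrecede (remainingTop r q)).card

theorem topCount_succ_two (r : ℕ) :
    topCount (r + 1) 2 = topCount r 0 + topCount r 1 + topCount r 2 := by
  simp only [topCount]
  rw [← remaining_zero]
  simp only [← remaining_three]
  rw [card_linExts_remaining_of_lt (by norm_num) (by norm_num),
    card_linExts_remaining_of_lt (p := 2) (q := 0 + 1) (by norm_num) (by norm_num),
    card_linExts_remaining_self (p := 2) (by norm_num)]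
  ring

theorem topCount_succ_one (r : ℕ) :
    topCount (r + 1) 1 = topCount r 0 + 2 * topCount r 1 + 2 * topCount r 2 := by
  have h := topCount_succ_two r
  simp only [topCount] at h ⊢
  rw [← remaining_zero] at h ⊢
  simp only [← remaining_three] at h ⊢
  rw [card_linExts_remaining_of_lt (by norm_num) (by norm_num),
    card_linExts_remaining_self (p := 1) (by norm_num), h,
    card_linExts_remaining_of_lt (p := 2) (q := 1) (by norm_num) (by norm_num),
    card_linExts_remaining_self (p := 2) (by norm_num)]
  ring

theorem topCount_succ_zero (r : ℕ) : topCount (r + 1) 0 = topCount (r + 1) 1 := by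
  simp only [topCount]
  rw [← remaining_zero, ← remaining_zero]
  exact card_linExts_remaining_self (by norm_num)

theorem topCount_zero_three : topCount 0 3 = 1 := by
  have h : remainingTop 0 3 = ∅ := by
    ext x
    simp only [remainingTop, Finset.mem_filter, Finset.mem_range, Finset.notMem_empty, iff_false]
    omega
  rw [topCount, h, Finset.card_eq_one]
  refine ⟨[], ?_⟩
  ext l
  simp only [mem_linExts, Finset.mem_singleton, Finset.empty_val]
  constructor
  · rintro ⟨h, -⟩
    exact (Multiset.coe_eq_zero l).1 h.symm
  · rintro rfl
    simp

theorem topCount_zero_succ {q : ℕ} (hq : q < 3) : topCount 0 q = topCount 0 (q + 1) := by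
  unfold topCount
  rw [card_linExts _ _ ⟨q, by simp [remainingTop]; omega⟩ {q} mustPrecede_irrefl]
  · rw [Finset.sum_singleton]
    congr 2
    ext x
    simp only [remainingTop, Finset.mem_erase, Finset.mem_filter, Finset.mem_range]
    omega
  · intro x
    simp only [remainingTop, Finset.mem_filter, Finset.mem_range, MustPrecede,
      Finset.mem_singleton]
    constructor
    · rintro rfl
      exact ⟨by omega, fun y hy => by omega⟩
    · rintro ⟨hx, h⟩
      have h1 := h (x - 1)
      omega

theorem linExt_avoids_iff (s : ℕ) (w : Equiv.Perm (Fin (s * 3))) :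
    (IsLinExtN s 3 w ∧ ¬ PermContains w pat2143) ↔
      ∀ i j, i < j → ¬ MustPrecede (w j : ℕ) (w i : ℕ) := by
  constructor
  · rintro ⟨⟨hrow, hcol⟩, havoid⟩ i j hij h
    rcases h with ⟨h, h3⟩ | h | ⟨h, h3⟩
    · have := hrow _ _ h h3
      simp only [Equiv.symm_apply_apply] at this
      exact absurd hij this.asymm
    · have := hcol _ _ h
      simp only [Equiv.symm_apply_apply] at this
      exact absurd hij this.asymm
    · apply havoid
      have hj := (w j).2
      let b : Fin (s * 3) := ⟨w i + 3, by omega⟩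
      let c : Fin (s * 3) := ⟨w i + 5, by omega⟩
      have hbi : w.symm b < i := by
        have := hcol b (w i) rfl
        rwa [Equiv.symm_apply_apply] at this
      have hjc : j < w.symm c := by
        have := hcol (w j) c (by simp only [c]; omega)
        rwa [Equiv.symm_apply_apply] at this
      refine ⟨![w.symm b, i, j, w.symm c], ?_, ?_⟩
      · rw [Fin.strictMono_iff_lt_succ]
        intro k
        fin_cases k
        · exact hbi
        · exact hij
        · exact hjc
      · intro k l
        rw [Fin.lt_def]
        fin_cases k <;> fin_cases l <;>
          simp [pat2143, b, c, -Fin.val_fin_lt] <;> omega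
  · intro H
    have hpos : ∀ a b : Fin (s * 3), MustPrecede a b → w.symm a < w.symm b := by
      intro a b hab
      by_contra hlt
      rcases (not_lt.1 hlt).lt_or_eq with h | h
      · exact H _ _ h (by simpa using hab)
      · rw [w.symm.injective h] at hab
        exact mustPrecede_irrefl _ hab
    have hrow : ∀ (d : ℕ) (a b : Fin (s * 3)), (b : ℕ) = a + d → (a : ℕ) / 3 = (b : ℕ) / 3 →
        w.symm a ≤ w.symm b := by
      intro d
      induction d with
      | zero => intro a b h _; rw [Fin.ext h]
      | succ d ih =>
        intro a b h hab
        have hb := b.2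
        refine (ih a ⟨a + d, by omega⟩ rfl (by simp only; omega)).trans (hpos _ _ ?_).le
        left
        simp only
        omega
    have hcol : ∀ (d : ℕ) (a b : Fin (s * 3)), (a : ℕ) = b + 3 * d → w.symm a ≤ w.symm b := by
      intro d
      induction d with
      | zero => intro a b h; rw [Fin.ext h]
      | succ d ih =>
        intro a b h
        have ha := a.2
        refine (hpos a ⟨b + 3 * d, by omega⟩ ?_).le.trans (ih _ b rfl)
        right; left
        simp only
        omega
    refine ⟨⟨fun a b h h3 => hpos a b (Or.inl ⟨h, h3⟩), fun a b h => hpos a b (Or.inr (Or.inl h))⟩,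
      ?_⟩
    rintro ⟨f, hf, hpat⟩
    have hinv : ∀ i j, i < j → w j < w i → (w j : ℕ) / 3 < (w i : ℕ) / 3 := by
      intro i j hij hlt
      by_contra hge
      have hlt' : (w j : ℕ) < w i := hlt
      have := hrow (w i - w j) (w j) (w i) (by omega) (by omega)
      simp only [Equiv.symm_apply_apply] at this
      exact absurd hij this.not_gt
    have h01 := hf (show (0 : Fin 4) < 1 by decide)
    have h12 := hf (show (1 : Fin 4) < 2 by decide)
    have h23 := hf (show (2 : Fin 4) < 3 by decide)
    have v10 := hinv _ _ h01 ((hpat 1 0).2 (by decide))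
    have v32 := hinv _ _ h23 ((hpat 3 2).2 (by decide))
    have v03 : (w (f 0) : ℕ) < w (f 3) := (hpat 0 3).2 (by decide)
    obtain ⟨x, hx⟩ : ∃ x, x = w (f 1) := ⟨_, rfl⟩
    obtain ⟨y, hy⟩ : ∃ y, y = w (f 2) := ⟨_, rfl⟩
    rw [← hx] at v10
    rw [← hy] at v32
    have hyn := y.2
    let y' : Fin (s * 3) := ⟨3 * (y / 3) + 2, by omega⟩
    let z : Fin (s * 3) := ⟨3 * (x / 3) + 8, by omega⟩
    let x' : Fin (s * 3) := ⟨3 * (x / 3), by omega⟩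
    have e1 : w.symm y ≤ w.symm y' := hrow (y' - y) y y' (by simp only [y']; omega)
      (by simp only [y']; omega)
    have e2 : w.symm y' ≤ w.symm z := hcol (y / 3 - x / 3 - 2) y' z
      (by simp only [y', z]; omega)
    have e3 : w.symm z < w.symm x' := hpos z x' (Or.inr (Or.inr ⟨rfl, Dvd.intro _ rfl⟩))
    have e4 : w.symm x' ≤ w.symm x := hrow (x - x') x' x (by simp only [x']; omega)
      (by simp only [x']; omega)
    have := ((e1.trans e2).trans_lt e3).trans_le e4
    rw [hx, hy, Equiv.symm_apply_apply, Equiv.symm_apply_apply] at this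
    exact absurd h12 this.asymm

/-- One-line notation identifies permutations subject to precedence constraints with lists. -/
theorem card_perm_eq_card_linExts (n : ℕ) (R : ℕ → ℕ → Prop) :
    Nat.card {w : Equiv.Perm (Fin n) // ∀ i j, i < j → ¬ R (w j : ℕ) (w i : ℕ)} =
      (linExts R (Finset.range n)).card := by
  rw [← Nat.card_eq_finsetCard]
  refine Nat.card_congr (Equiv.ofBijective
    (fun w => ⟨List.ofFn fun i => ((w.1 i : Fin n) : ℕ), mem_linExts.2 ⟨?_, ?_⟩⟩) ⟨?_, ?_⟩)
  · refine (Multiset.Nodup.ext (Finset.nodup _) (Multiset.coe_nodup.2 ?_)).2 fun x => ?_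
    · exact List.nodup_ofFn.2 (Fin.val_injective.comp w.1.injective)
    · simp only [Finset.mem_val, Finset.mem_range, Multiset.mem_coe, List.mem_ofFn]
      constructor
      · intro hx
        exact ⟨w.1.symm ⟨x, hx⟩, by simp⟩
      · rintro ⟨i, rfl⟩
        exact (w.1 i).2
  · exact List.pairwise_ofFn.2 fun i j hij => w.2 i j hij
  · intro w w' h
    have h' := List.ofFn_injective (Subtype.ext_iff.1 h)
    exact Subtype.ext (Equiv.ext fun i => Fin.ext (congrFun h' i))
  · rintro ⟨l, hl⟩
    obtain ⟨hval, hp⟩ := mem_linExts.1 hl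
    have hlen : l.length = n := by
      simpa using (congrArg Multiset.card hval).symm
    subst hlen
    have hlt : ∀ i : Fin l.length, l.get i < l.length := fun i => by
      have : l.get i ∈ (Finset.range l.length).val := by
        rw [hval]
        exact List.get_mem l i
      exact Finset.mem_range.1 this
    have hnd : l.Nodup := Multiset.coe_nodup.1 (hval ▸ Finset.nodup _)
    have hinj : Function.Injective fun i => (⟨l.get i, hlt i⟩ : Fin l.length) := fun i j h =>
      hnd.injective_get (Fin.ext_iff.1 h)
    refine ⟨⟨Equiv.ofBijective _ (Finite.injective_iff_bijective.1 hinj), fun i j hij => ?_⟩, ?_⟩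
    · exact List.pairwise_iff_get.1 hp i j hij
    · exact Subtype.ext (List.ofFn_get l)

/-- If `a_s` is the number of linear extensions of `N_{s,3}` avoiding `2143`, then
`a_1 = 1`, `a_2 = 5`, and `a_s = 4a_{s−1} + a_{s−2}` for all `s ≥ 3`. -/
theorem card_s_three_2143 (a : ℕ → ℕ)
    (ha : ∀ s : ℕ,
      a s = Nat.card {w : Equiv.Perm (Fin (s * 3)) // IsLinExtN s 3 w ∧ ¬ PermContains w pat2143}) :
    a 1 = 1 ∧ a 2 = 5 ∧ ∀ s : ℕ, 3 ≤ s → a s = 4 * a (s - 1) + a (s - 2) := by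
  have count : ∀ r, a (r + 1) = topCount r 0 := by
    intro r
    rw [ha, Nat.card_congr (Equiv.subtypeEquivRight (linExt_avoids_iff (r + 1))),
      card_perm_eq_card_linExts, topCount]
    congr 2
    ext x
    simp only [remainingTop, Finset.mem_filter, Finset.mem_range]
    omega
  have z2 : topCount 0 2 = 1 := (topCount_zero_succ (by norm_num)).trans topCount_zero_three
  have z1 : topCount 0 1 = 1 := (topCount_zero_succ (by norm_num)).trans z2
  have z0 : topCount 0 0 = 1 := (topCount_zero_succ (by norm_num)).trans z1
  refine ⟨by rw [count 0, z0], by rw [count 1, topCount_succ_zero, topCount_succ_one, z0, z1, z2],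
    fun s hs => ?_⟩
  obtain ⟨r, rfl⟩ := Nat.exists_eq_add_of_le' hs
  have e0 := topCount_succ_zero r
  have e1 := topCount_succ_one r
  have e2 := topCount_succ_two r
  have f0 : topCount (r + 2) 0 = topCount (r + 2) 1 := topCount_succ_zero (r + 1)
  have f1 : topCount (r + 2) 1 = _ := topCount_succ_one (r + 1)
  have c2 : a (r + 3) = _ := count (r + 2)
  have c1 : a (r + 3 - 1) = _ := count (r + 1)
  have c0 : a (r + 3 - 2) = _ := count r
  rw [c2, c1, c0]
  omega
end

section
/- For all integers s ≥ 2, the coefficient of r³ in F_s(r) equals (s³ + 6s² − 19s + 12)/6 (in particular, s³ + 6s² − 19s + 12 is divisible by 6). -/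
open Polynomial

/-- The polynomials `F_s`: `F_0 = F_1 = 1`, `F_s = (1+r+2r²)F_{s−1} + r³F_{s−2}` for `s ≥ 2`. -/
noncomputable def Fpoly : ℕ → Polynomial ℤ
  | 0 => 1
  | 1 => 1
  | s + 2 => (1 + X + 2 * X ^ 2) * Fpoly (s + 1) + X ^ 3 * Fpoly s

theorem Fpoly_coeff_zero : ∀ s, (Fpoly s).coeff 0 = 1
  | 0 => by simp [Fpoly]
  | 1 => by simp [Fpoly]
  | s + 2 => by simp [Fpoly, mul_coeff_zero, Fpoly_coeff_zero (s + 1)]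

theorem Fpoly_add_two (s : ℕ) :
    Fpoly (s + 2) = Fpoly (s + 1) + Fpoly (s + 1) * X ^ 1 + C 2 * (Fpoly (s + 1) * X ^ 2)
      + Fpoly s * X ^ 3 := by
  rw [Fpoly, show (C 2 : ℤ[X]) = 2 from rfl]
  ring

theorem Fpoly_succ_coeff_one (n : ℕ) : (Fpoly (n + 1)).coeff 1 = n := by
  induction n with
  | zero => simp [Fpoly, coeff_one]
  | succ n ih =>
    rw [Fpoly_add_two]
    simp only [coeff_add, coeff_C_mul, coeff_mul_X_pow']
    simp [ih, Fpoly_coeff_zero]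

theorem Fpoly_succ_coeff_two (n : ℕ) :
    2 * (Fpoly (n + 1)).coeff 2 = (n : ℤ) ^ 2 + 3 * n := by
  induction n with
  | zero => simp [Fpoly, coeff_one]
  | succ n ih =>
    rw [Fpoly_add_two]
    simp only [coeff_add, coeff_C_mul, coeff_mul_X_pow']
    simp [Fpoly_coeff_zero, Fpoly_succ_coeff_one]
    linear_combination ih

theorem six_mul_Fpoly_succ_coeff_three (n : ℕ) :
    6 * (Fpoly (n + 1)).coeff 3 = ((n : ℤ) + 1) ^ 3 + 6 * (n + 1) ^ 2 - 19 * (n + 1) + 12 := by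
  induction n with
  | zero => simp [Fpoly, coeff_one]
  | succ n ih =>
    rw [Fpoly_add_two]
    simp only [coeff_add, coeff_C_mul, coeff_mul_X_pow']
    simp [Fpoly_coeff_zero, Fpoly_succ_coeff_one]
    linear_combination ih + 3 * Fpoly_succ_coeff_two n

/-- For all `s ≥ 2`, the coefficient of `r³` in `F_s(r)` equals `(s³ + 6s² − 19s + 12)/6`;
in particular `6 ∣ s³ + 6s² − 19s + 12`. -/
theorem Fpoly_coeff_three (s : ℕ) (hs : 2 ≤ s) :
    (6 : ℤ) ∣ (s : ℤ) ^ 3 + 6 * (s : ℤ) ^ 2 - 19 * (s : ℤ) + 12 ∧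
    (Fpoly s).coeff 3 = ((s : ℤ) ^ 3 + 6 * (s : ℤ) ^ 2 - 19 * (s : ℤ) + 12) / 6 := by
  obtain ⟨n, rfl⟩ : ∃ n, s = n + 1 := ⟨s - 1, by omega⟩
  have h := six_mul_Fpoly_succ_coeff_three n
  push_cast
  rw [← h]
  exact ⟨dvd_mul_right _ _, by simp⟩
end

section
/- In the formal power series ring ℤ[[x]], one has Σ_{s≥0} e_s x^s = x(1 − 2x + x² + x³)/(1−2x)², where e_s denotes the coefficient of r^{2s−2} in F_s(r) (with e_0 = 0); equivalently, (1−2x)²·Σ_{s≥0} e_s x^s = x − 2x² + x³ + x⁴. In particular, for all s ≥ 4, the coefficient of r^{2s−2} in F_s(r) equals (3s+1)·2^{s−4}. -/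
open Polynomial

theorem Fpoly_coeff_add_three (s n : ℕ) :
    (Fpoly (s + 2)).coeff (n + 3) = (Fpoly (s + 1)).coeff (n + 3) + (Fpoly (s + 1)).coeff (n + 2) +
      2 * (Fpoly (s + 1)).coeff (n + 1) + (Fpoly s).coeff n := by
  have h : Fpoly (s + 2) = Fpoly (s + 1) + Fpoly (s + 1) * X ^ 1 + C 2 * (Fpoly (s + 1) * X ^ 2) +
      Fpoly s * X ^ 3 := by
    rw [Fpoly, show (C 2 : Polynomial ℤ) = 2 from rfl]
    ring
  rw [h, coeff_add, coeff_add, coeff_add, coeff_C_mul, coeff_mul_X_pow _ 3 n,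
    coeff_mul_X_pow _ 1 (n + 2), coeff_mul_X_pow _ 2 (n + 1)]

theorem Fpoly_two : Fpoly 2 = 1 + X + C 2 * X ^ 2 + X ^ 3 := by
  simp [Fpoly]

theorem Fpoly_coeff_two_two : (Fpoly 2).coeff 2 = 2 := by
  simp [Fpoly_two, coeff_one, coeff_X, coeff_X_pow]

theorem Fpoly_coeff_eq_zero (s : ℕ) :
    (∀ n, 2 * s + 1 ≤ n → (Fpoly s).coeff n = 0) ∧
      ∀ n, 2 * s + 2 ≤ n → (Fpoly (s + 1)).coeff n = 0 := by
  induction s with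
  | zero =>
    constructor <;> intro n hn <;> simp only [Fpoly, coeff_one] <;> exact if_neg (by omega)
  | succ s ih =>
    refine ⟨fun n hn => ih.2 n (by omega), fun n hn => ?_⟩
    obtain ⟨m, rfl⟩ : ∃ m, n = m + 3 := ⟨n - 3, by omega⟩
    rw [Fpoly_coeff_add_three, ih.2 _ (by omega), ih.2 _ (by omega), ih.2 _ (by omega),
      ih.1 _ (by omega)]
    norm_num

theorem Fpoly_leadingCoeff (s : ℕ) : (Fpoly (s + 2)).coeff (2 * s + 3) = 2 ^ s := by
  induction s with
  | zero => simp [Fpoly_two, coeff_one, coeff_X, coeff_X_pow]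
  | succ s ih =>
    rw [show 2 * (s + 1) + 3 = (2 * s + 2) + 3 by ring, Fpoly_coeff_add_three,
      (Fpoly_coeff_eq_zero (s + 1)).2 _ (by omega), (Fpoly_coeff_eq_zero (s + 1)).2 _ (by omega),
      ih]
    have h : (Fpoly (s + 1)).coeff (2 * s + 2) = 0 := (Fpoly_coeff_eq_zero s).2 _ le_rfl
    rw [h]
    ring

theorem Fpoly_coeff_succ (s : ℕ) :
    (Fpoly (s + 3)).coeff (2 * s + 4) =
      2 ^ s + 2 * (Fpoly (s + 2)).coeff (2 * s + 2) + (Fpoly (s + 1)).coeff (2 * s + 1) := by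
  rw [show 2 * s + 4 = (2 * s + 1) + 3 by ring, Fpoly_coeff_add_three,
    (Fpoly_coeff_eq_zero (s + 1)).2 _ (by omega), ← Fpoly_leadingCoeff s]
  ring

theorem Fpoly_coeff_three_four : (Fpoly 3).coeff 4 = 5 := by
  have h := Fpoly_coeff_succ 0
  norm_num [Fpoly_coeff_two_two] at h
  simpa [Fpoly, coeff_one] using h

theorem Fpoly_coeff_add_four (s : ℕ) :
    (Fpoly (s + 4)).coeff (2 * s + 6) = (3 * (s : ℤ) + 13) * 2 ^ s := by
  have hrec (k : ℕ) : (Fpoly (k + 4)).coeff (2 * k + 6) =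
      2 ^ (k + 1) + 2 * (Fpoly (k + 3)).coeff (2 * k + 4) + 2 ^ k := by
    have h := Fpoly_coeff_succ (k + 1)
    rwa [show 2 * (k + 1) + 1 = 2 * k + 3 by ring, Fpoly_leadingCoeff] at h
  induction s with
  | zero =>
    have h := hrec 0
    norm_num [Fpoly_coeff_three_four] at h
    simpa using h
  | succ s ih =>
    rw [hrec, show s + 1 + 3 = s + 4 by ring, show 2 * (s + 1) + 4 = 2 * s + 6 by ring, ih]
    push_cast
    ring

/-- Let `e_s` be the coefficient of `r^{2s−2}` in `F_s(r)` (with `e_0 = 0`).  Then in `ℤ[[x]]`,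
`Σ_s e_s xˢ = x(1 − 2x + x² + x³)/(1−2x)²`, i.e.
`(1−2x)² Σ_s e_s xˢ = x − 2x² + x³ + x⁴`; in particular, for all `s ≥ 4`,
the coefficient of `r^{2s−2}` in `F_s(r)` is `(3s+1)·2^{s−4}`. -/
theorem Fpoly_coeff_top (e : ℕ → ℤ) (he0 : e 0 = 0)
    (he : ∀ s : ℕ, 1 ≤ s → e s = (Fpoly s).coeff (2 * s - 2)) :
    (1 - 2 * PowerSeries.X) ^ 2 * PowerSeries.mk e =
      (PowerSeries.X : PowerSeries ℤ) - 2 * PowerSeries.X ^ 2 + PowerSeries.X ^ 3 +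
        PowerSeries.X ^ 4 ∧
    ∀ s : ℕ, 4 ≤ s → (Fpoly s).coeff (2 * s - 2) = (3 * (s : ℤ) + 1) * 2 ^ (s - 4) := by
  have top (s : ℕ) (hs : 4 ≤ s) :
      (Fpoly s).coeff (2 * s - 2) = (3 * (s : ℤ) + 1) * 2 ^ (s - 4) := by
    obtain ⟨k, rfl⟩ := Nat.exists_eq_add_of_le' hs
    rw [show 2 * (k + 4) - 2 = 2 * k + 6 by omega, Fpoly_coeff_add_four, Nat.add_sub_cancel]
    push_cast
    ring
  refine ⟨?_, top⟩
  have he1 : e 1 = 1 := by simp [he 1 le_rfl, Fpoly]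
  have he2 : e 2 = 2 := by simp [he 2 (by norm_num), Fpoly_coeff_two_two]
  have he3 : e 3 = 5 := by simp [he 3 (by norm_num), Fpoly_coeff_three_four]
  have he4 (k : ℕ) : e (k + 4) = (3 * (k : ℤ) + 13) * 2 ^ k := by
    rw [he _ (by omega), top _ (by omega), Nat.add_sub_cancel]
    push_cast
    ring
  have expand : (1 - 2 * PowerSeries.X) ^ 2 * PowerSeries.mk e =
      PowerSeries.mk e - PowerSeries.C 4 * (PowerSeries.mk e * PowerSeries.X ^ 1) +
        PowerSeries.C 4 * (PowerSeries.mk e * PowerSeries.X ^ 2) := by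
    rw [show (PowerSeries.C 4 : PowerSeries ℤ) = 4 from map_ofNat _ 4]
    ring
  rw [expand, show (2 : PowerSeries ℤ) = PowerSeries.C 2 from (map_ofNat _ 2).symm]
  ext n
  simp only [map_add, map_sub, PowerSeries.coeff_C_mul, PowerSeries.coeff_mul_X_pow',
    PowerSeries.coeff_mk, PowerSeries.coeff_C, PowerSeries.coeff_X_pow, PowerSeries.coeff_X]
  match n with
  | 0 => simp [he0]
  | 1 => simp [he0, he1]
  | 2 => simp [he0, he1, he2]
  | 3 => simp [he1, he2, he3]
  | 4 => simp [he2, he3, he4 0]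
  | 5 => simp [he3, he4 0, he4 1]
  | k + 6 =>
    have h4 := he4 k
    have h5 := he4 (k + 1)
    have h6 := he4 (k + 2)
    simp only [show k + 6 - 1 = k + 1 + 4 by omega, show k + 6 - 2 = k + 4 by omega,
      show k + 6 = k + 2 + 4 by omega, h4, h5, h6]
    simp
    ring
end
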